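/- For every ε > 0 there is a constant C > 0 such that for every real T ≥ 10 and every real y with 1 ≤ y ≤ T^{1/2}, one has ∫_T^{2T} |R₁(x;y)|^{16/3} dx ≤ C · T^{7+ε}. -/

import Mathlib

open Real Finset

/-- `R₁(x; y) = (x^{9/8}/(4π²)) ∑_{n ≤ y} (c_n/n^{7/8}) cos(8π(nx)^{1/4} − π/4)`. -/
noncomputable def R1 (c : ℕ → ℝ) (x y : ℝ) : ℝ :=
  x ^ ((9 : ℝ) / 8) / (4 * π ^ 2) *
    ∑ n ∈ Finset.Icc 1 ⌊y⌋₊,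
      c n / (n : ℝ) ^ ((7 : ℝ) / 8) * Real.cos (8 * π * ((n : ℝ) * x) ^ ((1 : ℝ) / 4) - π / 4)

/-- First-derivative estimate for the phase `α x^{1/4} + θ` on a dyadic interval. -/
theorem abs_integral_cos_rpow_quarter_le {T α : ℝ} (θ : ℝ) (hT : 0 < T) (hα : α ≠ 0) :
    |∫ x in T..(2 * T), cos (α * x ^ ((1 : ℝ) / 4) + θ)| ≤ 15 * T ^ ((3 : ℝ) / 4) / |α| := by
  have hpos : ∀ x ∈ Set.uIcc T (2 * T), T ≤ x := fun x hx => by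
    rw [Set.uIcc_of_le (by linarith)] at hx; exact hx.1
  have hderiv : ∀ x ∈ Set.uIcc T (2 * T), HasDerivAt
      (fun x : ℝ => 4 / α * (x ^ ((3 : ℝ) / 4) * sin (α * x ^ ((1 : ℝ) / 4) + θ)))
      (cos (α * x ^ ((1 : ℝ) / 4) + θ)
        + 3 / α * (x ^ (-(1 : ℝ) / 4) * sin (α * x ^ ((1 : ℝ) / 4) + θ))) x := by
    intro x hx
    have hx0 : 0 < x := hT.trans_le (hpos x hx)
    have h1 := (Real.hasDerivAt_rpow_const (x := x) (p := (1 : ℝ) / 4) (Or.inl hx0.ne'))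
    have h3 := (Real.hasDerivAt_rpow_const (x := x) (p := (3 : ℝ) / 4) (Or.inl hx0.ne'))
    have h := (h3.mul ((h1.const_mul α).add_const θ).sin).const_mul (4 / α)
    refine h.congr_deriv ?_
    have e1 : x ^ ((3 : ℝ) / 4) * x ^ ((1 : ℝ) / 4 - 1) = 1 := by
      rw [← rpow_add hx0]; norm_num
    have e2 : x ^ ((3 : ℝ) / 4 - 1) = x ^ (-(1 : ℝ) / 4) := by norm_num
    rw [e2]
    generalize x ^ ((1 : ℝ) / 4 - 1) = u at e1
    field_simp
    linear_combination (α * cos (α * x ^ ((1 : ℝ) / 4) + θ)) * e1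
  have hcos : Continuous fun x : ℝ => cos (α * x ^ ((1 : ℝ) / 4) + θ) := by
    have : Continuous fun x : ℝ => x ^ ((1 : ℝ) / 4) :=
      Real.continuous_rpow_const (by norm_num)
    fun_prop
  have hrest : ContinuousOn (fun x : ℝ =>
      3 / α * (x ^ (-(1 : ℝ) / 4) * sin (α * x ^ ((1 : ℝ) / 4) + θ))) (Set.uIcc T (2 * T)) := by
    have h1 : Continuous fun x : ℝ => x ^ ((1 : ℝ) / 4) :=
      Real.continuous_rpow_const (by norm_num)
    have h2 : ContinuousOn (fun x : ℝ => x ^ (-(1 : ℝ) / 4)) (Set.uIcc T (2 * T)) :=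
      continuousOn_id.rpow_const fun x hx => Or.inl (hT.trans_le (hpos x hx)).ne'
    exact continuousOn_const.mul (h2.mul (by fun_prop))
  have hI := intervalIntegral.integral_eq_sub_of_hasDerivAt hderiv
    (hcos.continuousOn.add hrest).intervalIntegrable
  rw [intervalIntegral.integral_add (hcos.intervalIntegrable _ _) hrest.intervalIntegrable] at hI
  have hα' : 0 < |α| := abs_pos.mpr hα
  have hTq : 0 < T ^ ((3 : ℝ) / 4) := rpow_pos_of_pos hT _
  have hR : |∫ x in T..(2 * T), 3 / α * (x ^ (-(1 : ℝ) / 4) * sin (α * x ^ ((1 : ℝ) / 4) + θ))|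
      ≤ 3 * T ^ ((3 : ℝ) / 4) / |α| := by
    have := intervalIntegral.norm_integral_le_of_norm_le_const (a := T) (b := 2 * T)
      (C := 3 / |α| * T ^ (-(1 : ℝ) / 4))
      (f := fun x => 3 / α * (x ^ (-(1 : ℝ) / 4) * sin (α * x ^ ((1 : ℝ) / 4) + θ))) (by
        intro x hx
        have hx' := hpos x (Set.uIoc_subset_uIcc hx)
        have hx0 : 0 < x := hT.trans_le hx'
        rw [norm_mul, norm_mul, norm_div, Real.norm_eq_abs, Real.norm_eq_abs α, Real.norm_eq_abs,
          Real.norm_eq_abs, abs_of_pos (by norm_num : (0 : ℝ) < 3),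
          abs_of_pos (rpow_pos_of_pos hx0 _)]
        gcongr 3 / |α| * ?_
        calc x ^ (-(1 : ℝ) / 4) * |sin (α * x ^ ((1 : ℝ) / 4) + θ)| ≤ x ^ (-(1 : ℝ) / 4) * 1 := by
              gcongr
              exact abs_sin_le_one _
          _ ≤ T ^ (-(1 : ℝ) / 4) := by
              rw [mul_one]
              exact rpow_le_rpow_of_nonpos hT hx' (by norm_num))
    rw [Real.norm_eq_abs] at this
    refine this.trans_eq ?_
    have e : T ^ (-(1 : ℝ) / 4) * T = T ^ ((3 : ℝ) / 4) := by
      rw [← rpow_add_one hT.ne']; norm_num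
    rw [show 2 * T - T = T by ring, abs_of_pos hT, ← e]
    ring
  have hB : ∀ x, 0 < x →
      |4 / α * (x ^ ((3 : ℝ) / 4) * sin (α * x ^ ((1 : ℝ) / 4) + θ))|
        ≤ 4 * x ^ ((3 : ℝ) / 4) / |α| := by
    intro x hx0
    rw [abs_mul, abs_mul, abs_div, abs_of_pos (by norm_num : (0 : ℝ) < 4),
      abs_of_pos (rpow_pos_of_pos hx0 _)]
    calc 4 / |α| * (x ^ ((3 : ℝ) / 4) * |sin (α * x ^ ((1 : ℝ) / 4) + θ)|)
        ≤ 4 / |α| * (x ^ ((3 : ℝ) / 4) * 1) := by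
          gcongr
          exact abs_sin_le_one _
      _ = _ := by ring
  have h2 : (2 * T) ^ ((3 : ℝ) / 4) ≤ 2 * T ^ ((3 : ℝ) / 4) := by
    rw [mul_rpow (by norm_num) hT.le]
    gcongr
    calc (2 : ℝ) ^ ((3 : ℝ) / 4) ≤ 2 ^ (1 : ℝ) :=
          rpow_le_rpow_of_exponent_le (by norm_num) (by norm_num)
      _ = 2 := rpow_one 2
  have hB1 := hB (2 * T) (by linarith)
  have hB2 := hB T hT
  have hB1' : 4 * (2 * T) ^ ((3 : ℝ) / 4) / |α| ≤ 8 * T ^ ((3 : ℝ) / 4) / |α| := by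
    refine div_le_div_of_nonneg_right ?_ hα'.le
    linarith
  rw [eq_sub_of_add_eq hI]
  refine (abs_sub _ _).trans ((add_le_add (abs_sub _ _) le_rfl).trans ?_)
  calc _ ≤ 8 * T ^ ((3 : ℝ) / 4) / |α| + 4 * T ^ ((3 : ℝ) / 4) / |α|
        + 3 * T ^ ((3 : ℝ) / 4) / |α| :=
        add_le_add (add_le_add (hB1.trans hB1') hB2) hR
    _ = _ := by ring

theorem abs_sub_le_mul_abs_rpow_quarter_sub {M a b : ℝ} (ha : 0 ≤ a) (hb : 0 ≤ b)
    (haM : a ≤ 2 * M) (hbM : b ≤ 2 * M) :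
    |a - b| ≤ 8 * M ^ ((3 : ℝ) / 4) * |a ^ ((1 : ℝ) / 4) - b ^ ((1 : ℝ) / 4)| := by
  have hM : 0 ≤ M := by linarith
  have key : ∀ t : ℝ, 0 ≤ t → (t ^ ((1 : ℝ) / 4)) ^ 4 = t := fun t ht => by
    rw [← rpow_natCast, ← rpow_mul ht]; norm_num
  have h3 : (2 * M) ^ ((3 : ℝ) / 4) ≤ 2 * M ^ ((3 : ℝ) / 4) := by
    rw [mul_rpow (by norm_num) hM]
    gcongr
    calc (2 : ℝ) ^ ((3 : ℝ) / 4) ≤ 2 ^ (1 : ℝ) :=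
          rpow_le_rpow_of_exponent_le (by norm_num) (by norm_num)
      _ = 2 := rpow_one 2
  have hr : ((2 * M) ^ ((1 : ℝ) / 4)) ^ 3 = (2 * M) ^ ((3 : ℝ) / 4) := by
    rw [← rpow_natCast, ← rpow_mul (by linarith)]; norm_num
  have hpr : a ^ ((1 : ℝ) / 4) ≤ (2 * M) ^ ((1 : ℝ) / 4) := by gcongr
  have hqr : b ^ ((1 : ℝ) / 4) ≤ (2 * M) ^ ((1 : ℝ) / 4) := by gcongr
  have hp0 : 0 ≤ a ^ ((1 : ℝ) / 4) := by positivity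
  have hq0 : 0 ≤ b ^ ((1 : ℝ) / 4) := by positivity
  have hp := key a ha
  have hq := key b hb
  set p := a ^ ((1 : ℝ) / 4)
  set q := b ^ ((1 : ℝ) / 4)
  set r := (2 * M) ^ ((1 : ℝ) / 4)
  have hf : a - b = (p + q) * (p ^ 2 + q ^ 2) * (p - q) := by rw [← hp, ← hq]; ring
  rw [hf, abs_mul, abs_of_nonneg (by positivity)]
  refine mul_le_mul_of_nonneg_right ?_ (abs_nonneg _)
  calc (p + q) * (p ^ 2 + q ^ 2) ≤ (r + r) * (r ^ 2 + r ^ 2) := by gcongr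
    _ = 4 * r ^ 3 := by ring
    _ ≤ _ := by rw [hr]; linarith

/-- The oscillating factor `cos(8π(nx)^{1/4} − π/4)`. -/
noncomputable def oscFactor (n : ℕ) (x : ℝ) : ℝ :=
  cos (8 * π * ((n : ℝ) * x) ^ ((1 : ℝ) / 4) - π / 4)

theorem continuous_oscFactor (n : ℕ) : Continuous (oscFactor n) := by
  have : Continuous fun x : ℝ => ((n : ℝ) * x) ^ ((1 : ℝ) / 4) :=
    (Real.continuous_rpow_const (by norm_num)).comp (continuous_const_mul _)
  unfold oscFactor
  fun_prop

theorem abs_oscFactor_le_one (n : ℕ) (x : ℝ) : |oscFactor n x| ≤ 1 := abs_cos_le_one _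

theorem abs_integral_oscFactor_mul_le {T : ℝ} (hT : 0 < T) {N n m : ℕ}
    (hn2 : n ≤ 2 * N) (hm2 : m ≤ 2 * N) :
    |∫ x in T..(2 * T), oscFactor n x * oscFactor m x| ≤
      (if n = m then T else 0)
        + 5 * T ^ ((3 : ℝ) / 4) * (N : ℝ) ^ ((3 : ℝ) / 4) * |(n : ℝ) - m|⁻¹ := by
  by_cases hnm : n = m
  · subst hnm
    have := intervalIntegral.norm_integral_le_of_norm_le_const (a := T) (b := 2 * T) (C := 1)
      (f := fun x => oscFactor n x * oscFactor n x) (fun x _ => by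
        rw [Real.norm_eq_abs, abs_mul]
        exact mul_le_one₀ (abs_oscFactor_le_one _ _) (abs_nonneg _) (abs_oscFactor_le_one _ _))
    rw [Real.norm_eq_abs, show 2 * T - T = T by ring, abs_of_pos hT, one_mul] at this
    simpa using this
  · rw [if_neg hnm, zero_add]
    have hd : 0 < |(n : ℝ) - m| := by
      rw [abs_pos, sub_ne_zero]; exact_mod_cast hnm
    have hgap := abs_sub_le_mul_abs_rpow_quarter_sub (M := N) (a := n) (b := m) (by positivity)
      (by positivity) (by exact_mod_cast hn2) (by exact_mod_cast hm2)
    have hp0 : 0 ≤ (n : ℝ) ^ ((1 : ℝ) / 4) := by positivity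
    have hq0 : 0 ≤ (m : ℝ) ^ ((1 : ℝ) / 4) := by positivity
    have heq : ∀ x ∈ Set.uIcc T (2 * T), oscFactor n x * oscFactor m x =
        1 / 2 * (cos (8 * π * ((n : ℝ) ^ ((1 : ℝ) / 4) - (m : ℝ) ^ ((1 : ℝ) / 4))
            * x ^ ((1 : ℝ) / 4) + 0)
          + cos (8 * π * ((n : ℝ) ^ ((1 : ℝ) / 4) + (m : ℝ) ^ ((1 : ℝ) / 4))
            * x ^ ((1 : ℝ) / 4) + (-(π / 2)))) := by
      intro x hx
      rw [Set.uIcc_of_le (by linarith)] at hx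
      have hx0 : 0 ≤ x := hT.le.trans hx.1
      unfold oscFactor
      rw [mul_rpow (by positivity) hx0, mul_rpow (by positivity) hx0]
      have h := two_mul_cos_mul_cos
        (8 * π * ((n : ℝ) ^ ((1 : ℝ) / 4) * x ^ ((1 : ℝ) / 4)) - π / 4)
        (8 * π * ((m : ℝ) ^ ((1 : ℝ) / 4) * x ^ ((1 : ℝ) / 4)) - π / 4)
      rw [mul_assoc] at h
      rw [eq_comm, one_div, inv_mul_eq_iff_eq_mul₀ two_ne_zero, h]
      congr 2 <;> ring
    rw [intervalIntegral.integral_congr heq, intervalIntegral.integral_const_mul]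
    have hc : ∀ α θ : ℝ, Continuous fun x : ℝ => cos (α * x ^ ((1 : ℝ) / 4) + θ) := fun α θ => by
      have : Continuous fun x : ℝ => x ^ ((1 : ℝ) / 4) :=
        Real.continuous_rpow_const (by norm_num)
      fun_prop
    rw [intervalIntegral.integral_add ((hc _ _).intervalIntegrable _ _)
      ((hc _ _).intervalIntegrable _ _)]
    set p := (n : ℝ) ^ ((1 : ℝ) / 4)
    set q := (m : ℝ) ^ ((1 : ℝ) / 4)
    set A := (N : ℝ) ^ ((3 : ℝ) / 4)
    have hA : 0 ≤ A := by positivity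
    have hpq : 0 < |p - q| := by
      by_contra! h
      have := le_antisymm h (abs_nonneg _)
      rw [this] at hgap; linarith
    have hpq' : |p - q| ≤ |p + q| := by
      rw [abs_of_nonneg (by positivity : 0 ≤ p + q), abs_le]; constructor <;> linarith
    have bound : ∀ z θ : ℝ, |p - q| ≤ |z| →
        |∫ x in T..(2 * T), cos (8 * π * z * x ^ ((1 : ℝ) / 4) + θ)| ≤
          5 * T ^ ((3 : ℝ) / 4) * A * |(n : ℝ) - m|⁻¹ := by
      intro z θ hz
      have hz0 : 0 < |z| := hpq.trans_le hz
      have hα : 8 * π * z ≠ 0 := mul_ne_zero (by positivity) (abs_pos.mp hz0)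
      refine (abs_integral_cos_rpow_quarter_le θ hT hα).trans ?_
      rw [abs_mul, abs_of_pos (by positivity : 0 < 8 * π), ← div_eq_mul_inv,
        div_le_div_iff₀ (by positivity) hd]
      have hTq : 0 < T ^ ((3 : ℝ) / 4) := rpow_pos_of_pos hT _
      calc 15 * T ^ ((3 : ℝ) / 4) * |(n : ℝ) - m|
          ≤ 15 * T ^ ((3 : ℝ) / 4) * (8 * A * |z|) := by
            gcongr; exact hgap.trans (by gcongr)
        _ = 5 * T ^ ((3 : ℝ) / 4) * A * (8 * 3 * |z|) := by ring
        _ ≤ _ := by gcongr; exact pi_gt_three.le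
    rw [abs_mul, abs_of_pos (by norm_num : (0 : ℝ) < 1 / 2)]
    have h1 := bound (p - q) 0 le_rfl
    have h2 := bound (p + q) (-(π / 2)) hpq'
    have h3 := abs_add_le (∫ x in T..(2 * T), cos (8 * π * (p - q) * x ^ ((1 : ℝ) / 4) + 0))
      (∫ x in T..(2 * T), cos (8 * π * (p + q) * x ^ ((1 : ℝ) / 4) + (-(π / 2))))
    linarith

theorem sum_inv_succ_le (k M : ℕ) (h : k ≤ M) :
    ∑ i ∈ range k, ((i : ℝ) + 1)⁻¹ ≤ 1 + log M := by
  have h1 := harmonic_le_one_add_log M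
  rw [harmonic] at h1
  push_cast at h1
  exact (sum_le_sum_of_subset_of_nonneg (range_mono h) fun _ _ _ => by positivity).trans h1

theorem sum_range_inv_abs_sub_le {n M : ℕ} (h : n < M) :
    ∑ m ∈ range M, |(n : ℝ) - m|⁻¹ ≤ 2 * (1 + log M) := by
  have hsplit : ∑ m ∈ range M, |(n : ℝ) - m|⁻¹ =
      ∑ i ∈ range n, ((i : ℝ) + 1)⁻¹ + ∑ i ∈ range (M - (n + 1)), ((i : ℝ) + 1)⁻¹ := by
    rw [← sum_range_add_sum_Ico _ (Nat.succ_le_of_lt h), sum_range_succ, sum_Ico_eq_sum_range]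
    congr 1
    · rw [← sum_range_reflect]
      simp only [sub_self, abs_zero, inv_zero, add_zero]
      refine sum_congr rfl fun i hi => ?_
      rw [mem_range] at hi
      rw [Nat.cast_sub (by omega), Nat.cast_sub (by omega)]
      push_cast
      rw [show (n : ℝ) - (n - 1 - i) = i + 1 by ring, abs_of_pos (by positivity)]
    · refine sum_congr rfl fun i _ => ?_
      push_cast
      rw [show (n : ℝ) - (n + 1 + i) = -(i + 1) by ring, abs_neg, abs_of_pos (by positivity)]
  rw [hsplit]
  have h1 := sum_inv_succ_le n M h.le
  have h2 := sum_inv_succ_le (M - (n + 1)) M (by omega)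
  linarith

theorem integral_sq_sum_oscFactor_le {T B : ℝ} (hT : 0 < T) {N : ℕ} {s : Finset ℕ}
    (hs : s ⊆ Ico N (2 * N)) {b : ℕ → ℝ} (hb0 : ∀ n ∈ s, 0 ≤ b n) (hbB : ∀ n ∈ s, b n ≤ B)
    (hB : 0 ≤ B) :
    ∫ x in T..(2 * T), (∑ n ∈ s, b n * oscFactor n x) ^ 2 ≤
      B ^ 2 * N * (T + 10 * T ^ ((3 : ℝ) / 4) * (N : ℝ) ^ ((3 : ℝ) / 4)
        * (1 + log (2 * N))) := by
  have hexp : ∀ x, (∑ n ∈ s, b n * oscFactor n x) ^ 2 =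
      ∑ n ∈ s, ∑ m ∈ s, b n * b m * (oscFactor n x * oscFactor m x) := fun x => by
    rw [sq, sum_mul_sum]
    exact sum_congr rfl fun n _ => sum_congr rfl fun m _ => by ring
  have hcont : ∀ n m, Continuous fun x => b n * b m * (oscFactor n x * oscFactor m x) :=
    fun n m => continuous_const.mul ((continuous_oscFactor n).mul (continuous_oscFactor m))
  simp_rw [hexp]
  rw [intervalIntegral.integral_finsetSum fun n _ =>
    (continuous_finsetSum _ fun m _ => hcont n m).intervalIntegrable _ _]
  set E := 5 * T ^ ((3 : ℝ) / 4) * (N : ℝ) ^ ((3 : ℝ) / 4) with hE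
  have hE0 : 0 ≤ E := by positivity
  have hrow : ∀ n ∈ s, ∫ x in T..(2 * T), ∑ m ∈ s, b n * b m * (oscFactor n x * oscFactor m x) ≤
      B ^ 2 * (T + E * (2 * (1 + log (2 * N)))) := by
    intro n hn
    rw [intervalIntegral.integral_finsetSum fun m _ => (hcont n m).intervalIntegrable _ _]
    have hnI := mem_Ico.mp (hs hn)
    calc ∑ m ∈ s, ∫ x in T..(2 * T), b n * b m * (oscFactor n x * oscFactor m x)
        ≤ ∑ m ∈ s, B ^ 2 * ((if n = m then T else 0) + E * |(n : ℝ) - m|⁻¹) := by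
          refine sum_le_sum fun m hm => ?_
          have hmI := mem_Ico.mp (hs hm)
          rw [intervalIntegral.integral_const_mul]
          have h := abs_integral_oscFactor_mul_le hT (N := N) hnI.2.le hmI.2.le
          calc _ ≤ b n * b m * |∫ x in T..(2 * T), oscFactor n x * oscFactor m x| :=
                mul_le_mul_of_nonneg_left (le_abs_self _) (mul_nonneg (hb0 n hn) (hb0 m hm))
            _ ≤ (B * B) * _ := mul_le_mul
                (mul_le_mul (hbB n hn) (hbB m hm) (hb0 m hm) hB) h (abs_nonneg _) (by positivity)
            _ = _ := by rw [sq]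
      _ = B ^ 2 * (T + E * ∑ m ∈ s, |(n : ℝ) - m|⁻¹) := by
          rw [← mul_sum, sum_add_distrib, ← mul_sum, sum_ite_eq, if_pos hn]
      _ ≤ _ := by
          gcongr
          have hsub : s ⊆ range (2 * N) := fun m hm => mem_range.mpr (mem_Ico.mp (hs hm)).2
          refine (sum_le_sum_of_subset_of_nonneg hsub fun _ _ _ => by positivity).trans ?_
          have := sum_range_inv_abs_sub_le hnI.2
          exact_mod_cast this
  refine (sum_le_card_nsmul s _ _ hrow).trans ?_
  have hlog : 0 ≤ 1 + log (2 * (N : ℝ)) := by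
    have := log_natCast_nonneg (2 * N)
    push_cast at this
    linarith
  have hcard : (#s : ℝ) ≤ N := by
    have := card_le_card hs
    rw [Nat.card_Ico] at this
    exact_mod_cast this.trans (by omega)
  rw [nsmul_eq_mul]
  calc (#s : ℝ) * (B ^ 2 * (T + E * (2 * (1 + log (2 * N)))))
      ≤ N * (B ^ 2 * (T + E * (2 * (1 + log (2 * N))))) := by gcongr
    _ = _ := by rw [hE]; ring

theorem integral_rpow_block_le {T B : ℝ} (hT : 1 ≤ T) {N : ℕ} (hN : 1 ≤ N)
    (hNT : (N : ℝ) ≤ T ^ ((1 : ℝ) / 2)) {s : Finset ℕ} (hs : s ⊆ Ico N (2 * N)) {a : ℕ → ℝ}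
    (ha0 : ∀ n ∈ s, 0 ≤ a n) (haB : ∀ n ∈ s, a n ≤ B) (hB : 0 ≤ B) :
    ∫ x in T..(2 * T), |∑ n ∈ s, a n / (n : ℝ) ^ ((7 : ℝ) / 8) * oscFactor n x| ^ ((16 : ℝ) / 3) ≤
      21 * B ^ ((16 : ℝ) / 3) * T * (1 + log T) := by
  have hT0 : 0 < T := by linarith
  have hN1 : (1 : ℝ) ≤ N := by exact_mod_cast hN
  have hN0 : (0 : ℝ) < N := by linarith
  set M : ℝ := (N : ℝ) with hM
  set D := B / M ^ ((7 : ℝ) / 8) with hD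
  have hD0 : 0 ≤ D := by positivity
  have hb0 : ∀ n ∈ s, 0 ≤ a n / (n : ℝ) ^ ((7 : ℝ) / 8) := fun n hn =>
    div_nonneg (ha0 n hn) (by positivity)
  have hbD : ∀ n ∈ s, a n / (n : ℝ) ^ ((7 : ℝ) / 8) ≤ D := fun n hn => by
    have hnN : M ≤ n := Nat.cast_le.mpr (mem_Ico.mp (hs hn)).1
    exact div_le_div₀ hB (haB n hn) (by positivity) (by gcongr)
  have hcard : (#s : ℝ) ≤ M := by
    have := card_le_card hs
    rw [Nat.card_Ico] at this
    exact Nat.cast_le.mpr (this.trans (by omega))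
  have hsup : ∀ x, |∑ n ∈ s, a n / (n : ℝ) ^ ((7 : ℝ) / 8) * oscFactor n x| ≤ M * D := fun x => by
    refine (abs_sum_le_sum_abs _ _).trans ((sum_le_card_nsmul s _ D fun n hn => ?_).trans ?_)
    · rw [abs_mul, abs_of_nonneg (hb0 n hn)]
      exact (mul_le_of_le_one_right (hb0 n hn) (abs_oscFactor_le_one _ _)).trans (hbD n hn)
    · rw [nsmul_eq_mul]
      gcongr
  have hcont : Continuous fun x => ∑ n ∈ s, a n / (n : ℝ) ^ ((7 : ℝ) / 8) * oscFactor n x :=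
    continuous_finsetSum _ fun n _ => continuous_const.mul (continuous_oscFactor n)
  have hpt : ∀ x, |∑ n ∈ s, a n / (n : ℝ) ^ ((7 : ℝ) / 8) * oscFactor n x| ^ ((16 : ℝ) / 3) ≤
      (M * D) ^ ((10 : ℝ) / 3)
        * (∑ n ∈ s, a n / (n : ℝ) ^ ((7 : ℝ) / 8) * oscFactor n x) ^ 2 := fun x => by
    rw [← sq_abs, ← rpow_two, show (16 : ℝ) / 3 = 10 / 3 + 2 by norm_num,
      rpow_add_of_nonneg (abs_nonneg _) (by norm_num) (by norm_num)]
    gcongr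
    exact hsup x
  have hmono : ∫ x in T..(2 * T),
      |∑ n ∈ s, a n / (n : ℝ) ^ ((7 : ℝ) / 8) * oscFactor n x| ^ ((16 : ℝ) / 3) ≤
      (M * D) ^ ((10 : ℝ) / 3) * ∫ x in T..(2 * T),
        (∑ n ∈ s, a n / (n : ℝ) ^ ((7 : ℝ) / 8) * oscFactor n x) ^ 2 := by
    rw [← intervalIntegral.integral_const_mul]
    refine intervalIntegral.integral_mono_on (by linarith) ?_ ?_ fun x _ => hpt x
    · exact (hcont.abs.rpow_const fun _ => Or.inr (by norm_num)).intervalIntegrable _ _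
    · exact (continuous_const.mul (hcont.pow 2)).intervalIntegrable _ _
  refine hmono.trans ((mul_le_mul_of_nonneg_left
    (integral_sq_sum_oscFactor_le hT0 hs hb0 hbD hD0) (by positivity)).trans ?_)
  rw [← hM]
  have hlogT : 0 ≤ log T := log_nonneg hT
  have hlog0 : 0 ≤ 1 + log (2 * M) := by
    have : 0 ≤ log (2 * M) := log_nonneg (by linarith)
    linarith
  have hlog : 1 + log (2 * M) ≤ 2 * (1 + log T) := by
    have h1 : log (2 * M) ≤ log (2 * T ^ ((1 : ℝ) / 2)) := by gcongr
    rw [log_mul two_ne_zero (rpow_pos_of_pos hT0 _).ne', log_rpow hT0] at h1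
    have := log_two_lt_d9
    linarith
  have hMD : M * D = B * M ^ ((1 : ℝ) / 8) := by
    rw [hD, mul_div_assoc', div_eq_iff (by positivity), mul_assoc, ← rpow_add hN0]
    norm_num; ring
  have hDM : D ^ 2 * M = B ^ 2 * M ^ (-(3 : ℝ) / 4) := by
    rw [hD, div_pow, ← rpow_natCast (M ^ ((7 : ℝ) / 8)), ← rpow_mul hN0.le, div_mul_eq_mul_div,
      div_eq_iff (by positivity), mul_assoc, ← rpow_add hN0]
    norm_num
  have hMD' : (M * D) ^ ((10 : ℝ) / 3) = B ^ ((10 : ℝ) / 3) * M ^ ((5 : ℝ) / 12) := by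
    rw [hMD, mul_rpow hB (by positivity), ← rpow_mul hN0.le]; norm_num
  have hBB : B ^ ((10 : ℝ) / 3) * B ^ 2 = B ^ ((16 : ℝ) / 3) := by
    rw [← rpow_two, ← rpow_add_of_nonneg hB (by norm_num) (by norm_num)]; norm_num
  have hM1 : M ^ ((5 : ℝ) / 12) * M ^ (-(3 : ℝ) / 4) ≤ 1 := by
    rw [← rpow_add hN0]
    exact rpow_le_one_of_one_le_of_nonpos hN1 (by norm_num)
  have hM2 : M ^ ((5 : ℝ) / 12) * M ^ (-(3 : ℝ) / 4) * (T ^ ((3 : ℝ) / 4) * M ^ ((3 : ℝ) / 4))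
      ≤ T := by
    have e : M ^ ((5 : ℝ) / 12) * M ^ (-(3 : ℝ) / 4) * M ^ ((3 : ℝ) / 4) = M ^ ((5 : ℝ) / 12) := by
      rw [← rpow_add hN0, ← rpow_add hN0]; norm_num
    calc _ = T ^ ((3 : ℝ) / 4) * M ^ ((5 : ℝ) / 12) := by
          linear_combination T ^ ((3 : ℝ) / 4) * e
      _ ≤ T ^ ((3 : ℝ) / 4) * (T ^ ((1 : ℝ) / 2)) ^ ((5 : ℝ) / 12) := by gcongr
      _ = T ^ ((23 : ℝ) / 24) := by rw [← rpow_mul hT0.le, ← rpow_add hT0]; norm_num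
      _ ≤ T ^ (1 : ℝ) := rpow_le_rpow_of_exponent_le hT (by norm_num)
      _ = T := rpow_one T
  rw [hMD', hDM]
  set P := M ^ ((5 : ℝ) / 12) * M ^ (-(3 : ℝ) / 4)
  set Q := T ^ ((3 : ℝ) / 4) * M ^ ((3 : ℝ) / 4)
  have hP : 0 ≤ P := by positivity
  have hQ : 0 ≤ Q := by positivity
  calc _ = B ^ ((16 : ℝ) / 3) * (P * T + 10 * (P * Q) * (1 + log (2 * M))) := by
        rw [← hBB]; ring
    _ ≤ B ^ ((16 : ℝ) / 3) * (1 * T + 10 * T * (2 * (1 + log T))) := by gcongr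
    _ ≤ _ := by
        have : 0 ≤ B ^ ((16 : ℝ) / 3) * (T * log T) := by positivity
        linarith

/-- Dyadic decomposition together with the Hölder inequality over the blocks. -/
theorem abs_sum_rpow_le_sum_dyadic {p : ℝ} (hp : 1 ≤ p) (f : ℕ → ℝ) {s : Finset ℕ} {k : ℕ}
    (hs : ∀ n ∈ s, Nat.log 2 n < k) :
    |∑ n ∈ s, f n| ^ p ≤
      (k : ℝ) ^ (p - 1) * ∑ j ∈ range k, |∑ n ∈ s with Nat.log 2 n = j, f n| ^ p := by
  rw [← sum_fiberwise_of_maps_to (t := range k) (fun n hn => mem_range.mpr (hs n hn))]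
  have h := Real.rpow_sum_le_const_mul_sum_rpow (range k)
    (fun j => ∑ n ∈ s with Nat.log 2 n = j, f n) hp
  rw [card_range] at h
  refine le_trans ?_ h
  gcongr
  exact abs_sum_le_sum_abs _ _

theorem integral_rpow_sum_oscFactor_le {T B : ℝ} (hT : 1 ≤ T) {Y : ℕ}
    (hYT : (Y : ℝ) ≤ T ^ ((1 : ℝ) / 2)) {a : ℕ → ℝ} (ha0 : ∀ n, 0 ≤ a n)
    (haB : ∀ n ∈ Icc 1 Y, a n ≤ B) (hB : 0 ≤ B) :
    ∫ x in T..(2 * T),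
      |∑ n ∈ Icc 1 Y, a n / (n : ℝ) ^ ((7 : ℝ) / 8) * oscFactor n x| ^ ((16 : ℝ) / 3) ≤
      21 * 2 ^ ((16 : ℝ) / 3) * B ^ ((16 : ℝ) / 3) * T * (1 + log T) ^ ((19 : ℝ) / 3) := by
  have hT0 : 0 < T := by linarith
  have hlogT : 0 ≤ log T := log_nonneg hT
  set k := Nat.log 2 Y + 1 with hk
  have hlt : ∀ n ∈ Icc 1 Y, Nat.log 2 n < k := fun n hn =>
    Nat.lt_succ_of_le (Nat.log_mono_right (mem_Icc.mp hn).2)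
  have hcont : ∀ s : Finset ℕ,
      Continuous fun x => ∑ n ∈ s, a n / (n : ℝ) ^ ((7 : ℝ) / 8) * oscFactor n x := fun s =>
    continuous_finsetSum _ fun n _ => continuous_const.mul (continuous_oscFactor n)
  have hcont' : ∀ s : Finset ℕ, Continuous fun x =>
      |∑ n ∈ s, a n / (n : ℝ) ^ ((7 : ℝ) / 8) * oscFactor n x| ^ ((16 : ℝ) / 3) := fun s =>
    (hcont s).abs.rpow_const fun _ => Or.inr (by norm_num)
  have hblock : ∀ j ∈ range k, ∫ x in T..(2 * T), |∑ n ∈ Icc 1 Y with Nat.log 2 n = j,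
      a n / (n : ℝ) ^ ((7 : ℝ) / 8) * oscFactor n x| ^ ((16 : ℝ) / 3) ≤
      21 * B ^ ((16 : ℝ) / 3) * T * (1 + log T) := by
    intro j _
    rcases (Finset.filter (fun n => Nat.log 2 n = j) (Icc 1 Y)).eq_empty_or_nonempty with h | h
    · rw [h]
      simp only [sum_empty, abs_zero]
      rw [zero_rpow (by norm_num), intervalIntegral.integral_zero]
      positivity
    · have hpow : ∀ n ∈ Finset.filter (fun n => Nat.log 2 n = j) (Icc 1 Y),
          2 ^ j ≤ n ∧ n < 2 * 2 ^ j := by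
        intro n hn
        rw [mem_filter, mem_Icc] at hn
        rw [← hn.2]
        refine ⟨Nat.pow_log_le_self 2 (by omega), ?_⟩
        rw [← pow_succ']
        exact Nat.lt_pow_succ_log_self (by norm_num) n
      obtain ⟨n, hn⟩ := h
      have hjY : 2 ^ j ≤ Y := (hpow n hn).1.trans (mem_Icc.mp (mem_filter.mp hn).1).2
      refine integral_rpow_block_le hT (N := 2 ^ j) Nat.one_le_two_pow
        (le_trans (by exact_mod_cast hjY) hYT) (fun n hn => mem_Ico.mpr (hpow n hn))
        (fun n _ => ha0 n) (fun n hn => haB n (mem_filter.mp hn).1) hB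
  have hkT : (k : ℝ) ≤ 2 * (1 + log T) := by
    have h1 : (Nat.log 2 Y : ℝ) * log 2 ≤ 1 / 2 * log T := by
      rcases Nat.eq_zero_or_pos Y with h | h
      · rw [h, Nat.log_zero_right]; simp; positivity
      · rw [← log_rpow hT0, ← log_pow]
        refine log_le_log (by positivity) (le_trans ?_ hYT)
        exact_mod_cast Nat.pow_log_le_self 2 h.ne'
    have h2 := log_two_gt_d9
    have h3 : (Nat.log 2 Y : ℝ) * (1 / 2) ≤ Nat.log 2 Y * log 2 := by gcongr; linarith
    rw [hk]; push_cast; linarith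
  have hk0 : (0 : ℝ) < k := by rw [hk]; positivity
  calc _ ≤ ∫ x in T..(2 * T), (k : ℝ) ^ ((16 : ℝ) / 3 - 1) * ∑ j ∈ range k,
        |∑ n ∈ Icc 1 Y with Nat.log 2 n = j,
          a n / (n : ℝ) ^ ((7 : ℝ) / 8) * oscFactor n x| ^ ((16 : ℝ) / 3) := by
        refine intervalIntegral.integral_mono_on (by linarith)
          ((hcont' _).intervalIntegrable _ _) ?_ fun x _ =>
            abs_sum_rpow_le_sum_dyadic (by norm_num) _ hlt
        exact (continuous_const.mul
          (continuous_finsetSum _ fun j _ => hcont' _)).intervalIntegrable _ _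
    _ ≤ (k : ℝ) ^ ((16 : ℝ) / 3 - 1) * (k * (21 * B ^ ((16 : ℝ) / 3) * T * (1 + log T))) := by
        rw [intervalIntegral.integral_const_mul, intervalIntegral.integral_finsetSum
          fun j _ => (hcont' _).intervalIntegrable _ _]
        gcongr
        refine (sum_le_card_nsmul _ _ _ hblock).trans_eq ?_
        rw [card_range, nsmul_eq_mul]
    _ = (k : ℝ) ^ ((16 : ℝ) / 3) * (21 * B ^ ((16 : ℝ) / 3) * T * (1 + log T)) := by
        rw [← mul_assoc, ← rpow_add_one hk0.ne']; norm_num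
    _ ≤ (2 * (1 + log T)) ^ ((16 : ℝ) / 3) * (21 * B ^ ((16 : ℝ) / 3) * T * (1 + log T)) := by
        gcongr
    _ = _ := by
        have e : (1 + log T) ^ ((19 : ℝ) / 3) = (1 + log T) ^ ((16 : ℝ) / 3) * (1 + log T) := by
          rw [← rpow_add_one (by positivity)]; norm_num
        rw [mul_rpow (by norm_num) (by positivity), e]
        ring

theorem stmt_6 (c : ℕ → ℝ) (hc0 : ∀ n, 0 ≤ c n)
    (hc : ∀ ε : ℝ, 0 < ε → ∃ K : ℝ, 0 < K ∧ ∀ n : ℕ, 1 ≤ n → c n ≤ K * (n : ℝ) ^ ε)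
    (ε : ℝ) (hε : 0 < ε) :
    ∃ C : ℝ, 0 < C ∧ ∀ T y : ℝ, 10 ≤ T → 1 ≤ y → y ≤ T ^ ((1 : ℝ) / 2) →
      (∫ x in T..(2 * T), |R1 c x y| ^ ((16 : ℝ) / 3)) ≤ C * T ^ (7 + ε) := by
  set δ := ε * (3 / 35) with hδ
  have hδ0 : 0 < δ := by positivity
  obtain ⟨K, hK0, hK⟩ := hc δ hδ0
  refine ⟨2 ^ (6 : ℝ) * (21 * 2 ^ ((16 : ℝ) / 3) * K ^ ((16 : ℝ) / 3)
    * (1 + 1 / δ) ^ ((19 : ℝ) / 3)), by positivity, fun T y hT hy hyT => ?_⟩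
  have hT0 : 0 < T := by linarith
  have hT1 : 1 ≤ T := by linarith
  have hY : ((⌊y⌋₊ : ℕ) : ℝ) ≤ T ^ ((1 : ℝ) / 2) := (Nat.floor_le (by linarith)).trans hyT
  have hTT : T ^ ((1 : ℝ) / 2) ≤ T := by
    conv_rhs => rw [← rpow_one T]
    exact rpow_le_rpow_of_exponent_le hT1 (by norm_num)
  have hcB : ∀ n ∈ Icc 1 ⌊y⌋₊, c n ≤ K * T ^ δ := fun n hn => by
    rw [mem_Icc] at hn
    refine (hK n hn.1).trans ?_
    have : (n : ℝ) ≤ T := le_trans (by exact_mod_cast hn.2) (hY.trans hTT)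
    gcongr
  have hmain := integral_rpow_sum_oscFactor_le hT1 hY hc0 hcB (by positivity)
  have hcont : Continuous fun x =>
      ∑ n ∈ Icc 1 ⌊y⌋₊, c n / (n : ℝ) ^ ((7 : ℝ) / 8) * oscFactor n x :=
    continuous_finsetSum _ fun n _ => continuous_const.mul (continuous_oscFactor n)
  have hR1 : ∀ x, R1 c x y = x ^ ((9 : ℝ) / 8) / (4 * π ^ 2) *
      ∑ n ∈ Icc 1 ⌊y⌋₊, c n / (n : ℝ) ^ ((7 : ℝ) / 8) * oscFactor n x := fun _ => rfl
  have hpt : ∀ x ∈ Set.Icc T (2 * T), |R1 c x y| ^ ((16 : ℝ) / 3) ≤ (2 * T) ^ (6 : ℝ) *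
      |∑ n ∈ Icc 1 ⌊y⌋₊, c n / (n : ℝ) ^ ((7 : ℝ) / 8) * oscFactor n x| ^ ((16 : ℝ) / 3) := by
    intro x hx
    have hx0 : 0 < x := hT0.trans_le hx.1
    have hπ : 1 ≤ 4 * π ^ 2 := by nlinarith [pi_gt_three]
    have e : (2 * T) ^ (6 : ℝ) = ((2 * T) ^ ((9 : ℝ) / 8)) ^ ((16 : ℝ) / 3) := by
      rw [← rpow_mul (by positivity)]; norm_num
    rw [hR1, abs_mul, abs_of_nonneg (by positivity : 0 ≤ x ^ ((9 : ℝ) / 8) / (4 * π ^ 2)),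
      mul_rpow (by positivity) (abs_nonneg _), e]
    gcongr
    exact (div_le_self (by positivity) hπ).trans (by gcongr; exact hx.2)
  have hcS : Continuous fun x => |∑ n ∈ Icc 1 ⌊y⌋₊,
      c n / (n : ℝ) ^ ((7 : ℝ) / 8) * oscFactor n x| ^ ((16 : ℝ) / 3) :=
    hcont.abs.rpow_const fun _ => Or.inr (by norm_num)
  have hcR : Continuous fun x => |R1 c x y| ^ ((16 : ℝ) / 3) := by
    simp_rw [hR1]
    exact (((Real.continuous_rpow_const (by norm_num)).div_const _).mul hcont).abs.rpow_const
      fun _ => Or.inr (by norm_num)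
  have hlogT : 0 ≤ log T := log_nonneg hT1
  have hL : 1 + log T ≤ (1 + 1 / δ) * T ^ δ := by
    have h1 := log_le_rpow_div hT0.le hδ0
    have h2 := one_le_rpow hT1 hδ0.le
    calc 1 + log T ≤ T ^ δ + T ^ δ / δ := add_le_add h2 h1
      _ = _ := by ring
  calc _ ≤ (2 * T) ^ (6 : ℝ) * ∫ x in T..(2 * T), |∑ n ∈ Icc 1 ⌊y⌋₊,
        c n / (n : ℝ) ^ ((7 : ℝ) / 8) * oscFactor n x| ^ ((16 : ℝ) / 3) := by
        rw [← intervalIntegral.integral_const_mul]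
        exact intervalIntegral.integral_mono_on (by linarith) (hcR.intervalIntegrable _ _)
          ((continuous_const.mul hcS).intervalIntegrable _ _) hpt
    _ ≤ (2 * T) ^ (6 : ℝ) * (21 * 2 ^ ((16 : ℝ) / 3) * (K * T ^ δ) ^ ((16 : ℝ) / 3) * T
        * ((1 + 1 / δ) * T ^ δ) ^ ((19 : ℝ) / 3)) := by
        refine mul_le_mul_of_nonneg_left (hmain.trans ?_) (by positivity)
        gcongr
    _ = _ := by
        have e : T ^ (7 + ε) =
            T ^ (6 : ℝ) * (T ^ δ) ^ ((16 : ℝ) / 3) * T * (T ^ δ) ^ ((19 : ℝ) / 3) := by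
          rw [← rpow_mul hT0.le, ← rpow_mul hT0.le, ← rpow_add hT0, ← rpow_add_one hT0.ne',
            ← rpow_add hT0, hδ]
          congr 1
          ring
        rw [e, mul_rpow (by norm_num) hT0.le, mul_rpow hK0.le (by positivity),
          mul_rpow (by positivity) (by positivity)]
        ring
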